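/- If p is a well-typed program of call-by-name λFv (a closed plain term typable in empty environments), then the call-by-name evaluation of p terminates: there exists a value v such that p →n* v. -/

import Mathlib

/-!
Language `λFv`: explicitly typed System F extended with the abortive control
operator `callcc` and a `throw` construct, in de Bruijn representation
(separate de Bruijn indices for term variables, continuation variables and
type variables).
-/

namespace LambdaFv

/-- Types of System F: type variables (de Bruijn), arrow types, universal types. -/
inductive Ty : Type where
  | var : Nat → Ty
  | arrow : Ty → Ty → Ty
  | all : Ty → Ty

/-- Lifting of a renaming under a binder. -/
def liftRen (ρ : Nat → Nat) : Nat → Nat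
  | 0 => 0
  | n+1 => ρ n + 1

/-- Renaming of type variables in a type. -/
def renTy (ρ : Nat → Nat) : Ty → Ty
  | .var n => .var (ρ n)
  | .arrow a b => .arrow (renTy ρ a) (renTy ρ b)
  | .all a => .all (renTy (liftRen ρ) a)

/-- Lifting of a type substitution under a type binder. -/
def liftTySub (σ : Nat → Ty) : Nat → Ty
  | 0 => .var 0
  | n+1 => renTy Nat.succ (σ n)

/-- Simultaneous substitution of types for type variables in a type. -/
def subTy (σ : Nat → Ty) : Ty → Ty
  | .var n => σ n
  | .arrow a b => .arrow (subTy σ a) (subTy σ b)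
  | .all a => .all (subTy (liftTySub σ) a)

/-- `subTy0 U S` is `S[α₀ := U]` (instantiation of the type variable 0). -/
def subTy0 (U : Ty) (S : Ty) : Ty :=
  subTy (fun n => match n with | 0 => U | n+1 => .var n) S

/-- `subTyList Ts S` is `S[ᾱ := Ts]`: simultaneous substitution of the types
`Ts` for the free type variables of `S`. -/
def subTyList (Ts : List Ty) (S : Ty) : Ty :=
  subTy (fun n => Ts.getD n (.var n)) S

/-- `ScopedTy p S`: all free type variables of `S` are among `α₀,…,α_{p-1}`. -/
inductive ScopedTy : Nat → Ty → Prop where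
  | var : ∀ {p n}, n < p → ScopedTy p (.var n)
  | arrow : ∀ {p a b}, ScopedTy p a → ScopedTy p b → ScopedTy p (.arrow a b)
  | all : ∀ {p a}, ScopedTy (p+1) a → ScopedTy p (.all a)

/-- A closed type: no free type variables. -/
def ClosedTy (S : Ty) : Prop := ScopedTy 0 S

mutual
/-- Terms of `λFv`:
variables, `λx:S.t`, application, `Λα.t`, type application, `K k.t` (callcc),
`k ← t` (throw to a continuation variable), `⌈E⌉ ← t` (throw to a reified context). -/
inductive Tm : Type where
  | var : Nat → Tm
  | lam : Ty → Tm → Tm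
  | app : Tm → Tm → Tm
  | tlam : Tm → Tm
  | tapp : Tm → Ty → Tm
  | callcc : Tm → Tm
  | throwVar : Nat → Tm → Tm
  | throwCtx : Ctx → Tm → Tm

/-- Call-by-value evaluation contexts, represented inside-out:
`[]`, `(λx:S.t)·E`, `E t`, `E S`, `⌈E₀⌉ ← E`. -/
inductive Ctx : Type where
  | hole : Ctx
  | lamApp : Ty → Tm → Ctx → Ctx
  | app : Ctx → Tm → Ctx
  | tapp : Ctx → Ty → Ctx
  | throw : Ctx → Ctx → Ctx
end

/-- Plugging a term in a context (contexts are represented inside-out). -/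
def plug : Tm → Ctx → Tm
  | t, .hole => t
  | t, .lamApp S b E => plug (.app (.lam S b) t) E
  | t, .app E u => plug (.app t u) E
  | t, .tapp E S => plug (.tapp t S) E
  | t, .throw E0 E => plug (.throwCtx E0 t) E

/-- Values: λ-abstractions and Λ-abstractions. -/
inductive IsValue : Tm → Prop where
  | lam : ∀ {S t}, IsValue (.lam S t)
  | tlam : ∀ {t}, IsValue (.tlam t)

/-- Plain terms: terms with no subterm of the form `⌈E⌉ ← t`. -/
inductive Plain : Tm → Prop where
  | var : ∀ {n}, Plain (.var n)
  | lam : ∀ {S t}, Plain t → Plain (.lam S t)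
  | app : ∀ {a b}, Plain a → Plain b → Plain (.app a b)
  | tlam : ∀ {t}, Plain t → Plain (.tlam t)
  | tapp : ∀ {t S}, Plain t → Plain (.tapp t S)
  | callcc : ∀ {t}, Plain t → Plain (.callcc t)
  | throwVar : ∀ {k t}, Plain t → Plain (.throwVar k t)

mutual
/-- `ScTm n m p t`: the free term variables of `t` are `< n`, its free
continuation variables are `< m` and its free type variables are `< p`. -/
inductive ScTm : Nat → Nat → Nat → Tm → Prop where
  | var : ∀ {n m p x}, x < n → ScTm n m p (.var x)
  | lam : ∀ {n m p S t}, ScopedTy p S → ScTm (n+1) m p t → ScTm n m p (.lam S t)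
  | app : ∀ {n m p a b}, ScTm n m p a → ScTm n m p b → ScTm n m p (.app a b)
  | tlam : ∀ {n m p t}, ScTm n m (p+1) t → ScTm n m p (.tlam t)
  | tapp : ∀ {n m p t S}, ScTm n m p t → ScopedTy p S → ScTm n m p (.tapp t S)
  | callcc : ∀ {n m p t}, ScTm n (m+1) p t → ScTm n m p (.callcc t)
  | throwVar : ∀ {n m p k t}, k < m → ScTm n m p t → ScTm n m p (.throwVar k t)
  | throwCtx : ∀ {n m p E t}, ScCtx n m p E → ScTm n m p t → ScTm n m p (.throwCtx E t)

/-- Scoping predicate for contexts. -/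
inductive ScCtx : Nat → Nat → Nat → Ctx → Prop where
  | hole : ∀ {n m p}, ScCtx n m p .hole
  | lamApp : ∀ {n m p S t E}, ScopedTy p S → ScTm (n+1) m p t → ScCtx n m p E →
      ScCtx n m p (.lamApp S t E)
  | app : ∀ {n m p E t}, ScCtx n m p E → ScTm n m p t → ScCtx n m p (.app E t)
  | tapp : ∀ {n m p E S}, ScCtx n m p E → ScopedTy p S → ScCtx n m p (.tapp E S)
  | throw : ∀ {n m p E0 E1}, ScCtx n m p E0 → ScCtx n m p E1 → ScCtx n m p (.throw E0 E1)
end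

/-- A closed term: no free variables of any kind. -/
def ClosedTm (t : Tm) : Prop := ScTm 0 0 0 t

/-- A closed context: no free variables of any kind. -/
def ClosedCtx (E : Ctx) : Prop := ScCtx 0 0 0 E

mutual
/-- Renaming of the three kinds of variables in terms. -/
def renTm (ρx ρk ρa : Nat → Nat) : Tm → Tm
  | .var n => .var (ρx n)
  | .lam S t => .lam (renTy ρa S) (renTm (liftRen ρx) ρk ρa t)
  | .app a b => .app (renTm ρx ρk ρa a) (renTm ρx ρk ρa b)
  | .tlam t => .tlam (renTm ρx ρk (liftRen ρa) t)
  | .tapp t S => .tapp (renTm ρx ρk ρa t) (renTy ρa S)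
  | .callcc t => .callcc (renTm ρx (liftRen ρk) ρa t)
  | .throwVar k t => .throwVar (ρk k) (renTm ρx ρk ρa t)
  | .throwCtx E t => .throwCtx (renCtx ρx ρk ρa E) (renTm ρx ρk ρa t)

/-- Renaming of the three kinds of variables in contexts. -/
def renCtx (ρx ρk ρa : Nat → Nat) : Ctx → Ctx
  | .hole => .hole
  | .lamApp S t E => .lamApp (renTy ρa S) (renTm (liftRen ρx) ρk ρa t) (renCtx ρx ρk ρa E)
  | .app E t => .app (renCtx ρx ρk ρa E) (renTm ρx ρk ρa t)
  | .tapp E S => .tapp (renCtx ρx ρk ρa E) (renTy ρa S)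
  | .throw E0 E => .throw (renCtx ρx ρk ρa E0) (renCtx ρx ρk ρa E)
end

/-- An entry of a continuation substitution: either a reified context or a
continuation variable. -/
def mapKEnt (f : Ctx → Ctx) : Ctx ⊕ Nat → Ctx ⊕ Nat
  | .inl E => .inl (f E)
  | .inr n => .inr n

/-- Lifting of a term substitution under a term binder. -/
def liftSubX (σ : Nat → Tm) : Nat → Tm
  | 0 => .var 0
  | n+1 => renTm Nat.succ id id (σ n)

/-- Shifting of a term substitution under a continuation binder. -/
def shiftSubXk (σ : Nat → Tm) : Nat → Tm := fun n => renTm id Nat.succ id (σ n)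

/-- Shifting of a term substitution under a type binder. -/
def shiftSubXa (σ : Nat → Tm) : Nat → Tm := fun n => renTm id id Nat.succ (σ n)

/-- Lifting of a continuation substitution under a continuation binder. -/
def liftSubK (σ : Nat → Ctx ⊕ Nat) : Nat → Ctx ⊕ Nat
  | 0 => .inr 0
  | n+1 =>
    match σ n with
    | .inl E => .inl (renCtx id Nat.succ id E)
    | .inr m => .inr (m+1)

/-- Shifting of a continuation substitution under a term binder. -/
def shiftSubKx (σ : Nat → Ctx ⊕ Nat) : Nat → Ctx ⊕ Nat :=
  fun n => mapKEnt (renCtx Nat.succ id id) (σ n)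

/-- Shifting of a continuation substitution under a type binder. -/
def shiftSubKa (σ : Nat → Ctx ⊕ Nat) : Nat → Ctx ⊕ Nat :=
  fun n => mapKEnt (renCtx id id Nat.succ) (σ n)

mutual
/-- Simultaneous capture-avoiding substitution in terms: `σx` substitutes terms for
term variables, `σk` substitutes reified contexts for continuation variables,
`σa` substitutes types for type variables. -/
def subTm (σx : Nat → Tm) (σk : Nat → Ctx ⊕ Nat) (σa : Nat → Ty) : Tm → Tm
  | .var n => σx n
  | .lam S t => .lam (subTy σa S) (subTm (liftSubX σx) (shiftSubKx σk) σa t)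
  | .app a b => .app (subTm σx σk σa a) (subTm σx σk σa b)
  | .tlam t => .tlam (subTm (shiftSubXa σx) (shiftSubKa σk) (liftTySub σa) t)
  | .tapp t S => .tapp (subTm σx σk σa t) (subTy σa S)
  | .callcc t => .callcc (subTm (shiftSubXk σx) (liftSubK σk) σa t)
  | .throwVar k t =>
    match σk k with
    | .inl E => .throwCtx E (subTm σx σk σa t)
    | .inr m => .throwVar m (subTm σx σk σa t)
  | .throwCtx E t => .throwCtx (subCtx σx σk σa E) (subTm σx σk σa t)

/-- Simultaneous capture-avoiding substitution in contexts. -/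
def subCtx (σx : Nat → Tm) (σk : Nat → Ctx ⊕ Nat) (σa : Nat → Ty) : Ctx → Ctx
  | .hole => .hole
  | .lamApp S t E => .lamApp (subTy σa S) (subTm (liftSubX σx) (shiftSubKx σk) σa t) (subCtx σx σk σa E)
  | .app E t => .app (subCtx σx σk σa E) (subTm σx σk σa t)
  | .tapp E S => .tapp (subCtx σx σk σa E) (subTy σa S)
  | .throw E0 E => .throw (subCtx σx σk σa E0) (subCtx σx σk σa E)
end

/-- `sub0X v t` is `t[x₀ := v]`. -/
def sub0X (v : Tm) (t : Tm) : Tm :=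
  subTm (fun n => match n with | 0 => v | n+1 => .var n) Sum.inr Ty.var t

/-- `sub0A S t` is `t[α₀ := S]`. -/
def sub0A (S : Ty) (t : Tm) : Tm :=
  subTm Tm.var Sum.inr (fun n => match n with | 0 => S | n+1 => .var n) t

/-- `sub0K E t` is `t[k₀ := ⌈E⌉]`. -/
def sub0K (E : Ctx) (t : Tm) : Tm :=
  subTm Tm.var (fun n => match n with | 0 => .inl E | n+1 => .inr n) Ty.var t

/-- `msub Vs vs Es t` is the simultaneous substitution
`t[ᾱ := Vs][x̄ := vs][k̄ := ⌈Es⌉]`. -/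
def msub (Vs : List Ty) (vs : List Tm) (Es : List Ctx) (t : Tm) : Tm :=
  subTm (fun n => vs.getD n (.var n))
        (fun n => match Es[n]? with | some E => .inl E | none => .inr n)
        (fun n => Vs.getD n (.var n)) t

mutual
/-- The type system of Figure 1: typing of terms, `Γ;Δ ⊢ t : S`.
`Γ` assigns types to term variables; `Δ` assigns context types `¬S`
(represented by their hole type `S`) to continuation variables. -/
inductive HasTy : List Ty → List Ty → Tm → Ty → Prop where
  | var : ∀ {Γ Δ x S}, Γ[x]? = some S → HasTy Γ Δ (.var x) S
  | lam : ∀ {Γ Δ S T t}, HasTy (S::Γ) Δ t T → HasTy Γ Δ (.lam S t) (.arrow S T)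
  | app : ∀ {Γ Δ S T t0 t1}, HasTy Γ Δ t0 (.arrow S T) → HasTy Γ Δ t1 S →
      HasTy Γ Δ (.app t0 t1) T
  | tlam : ∀ {Γ Δ t S}, HasTy (Γ.map (renTy Nat.succ)) (Δ.map (renTy Nat.succ)) t S →
      HasTy Γ Δ (.tlam t) (.all S)
  | tapp : ∀ {Γ Δ t S T}, HasTy Γ Δ t (.all S) → HasTy Γ Δ (.tapp t T) (subTy0 T S)
  | callcc : ∀ {Γ Δ t S}, HasTy Γ (S::Δ) t S → HasTy Γ Δ (.callcc t) S
  | throwVar : ∀ {Γ Δ k t S T}, Δ[k]? = some S → HasTy Γ Δ t S →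
      HasTy Γ Δ (.throwVar k t) T
  | throwCtx : ∀ {Γ Δ E t S T}, HasTyCtx Γ Δ E S → HasTy Γ Δ t S →
      HasTy Γ Δ (.throwCtx E t) T

/-- The type system of Figure 1: typing of contexts, `Γ;Δ ⊢ E : ¬S`. -/
inductive HasTyCtx : List Ty → List Ty → Ctx → Ty → Prop where
  | hole : ∀ {Γ Δ S}, HasTyCtx Γ Δ .hole S
  | lamApp : ∀ {Γ Δ S T t E}, HasTy Γ Δ (.lam S t) (.arrow S T) → HasTyCtx Γ Δ E T →
      HasTyCtx Γ Δ (.lamApp S t E) S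
  | app : ∀ {Γ Δ S T t E}, HasTy Γ Δ t S → HasTyCtx Γ Δ E T →
      HasTyCtx Γ Δ (.app E t) (.arrow S T)
  | tapp : ∀ {Γ Δ S T E}, HasTyCtx Γ Δ E (subTy0 T S) → HasTyCtx Γ Δ (.tapp E T) (.all S)
  | throw : ∀ {Γ Δ S T E0 E1}, HasTyCtx Γ Δ E0 S → HasTyCtx Γ Δ E1 T →
      HasTyCtx Γ Δ (.throw E0 E1) S
end

/-- The call-by-value one-step reduction relation `→v` of `λFv`. -/
inductive Step : Tm → Tm → Prop where
  | beta : ∀ {S t v E}, IsValue v →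
      Step (plug (.app (.lam S t) v) E) (plug (sub0X v t) E)
  | betaT : ∀ {t S E},
      Step (plug (.tapp (.tlam t) S) E) (plug (sub0A S t) E)
  | callcc : ∀ {t E},
      Step (plug (.callcc t) E) (plug (sub0K E t) E)
  | throw : ∀ {E0 E1 v}, IsValue v →
      Step (plug (.throwCtx E0 v) E1) (plug v E0)

/-- Call-by-value evaluation: the reflexive-transitive closure of `→v`. -/
def Steps : Tm → Tm → Prop := Relation.ReflTransGen Step

/-- Redexes of `λFv` under call by value. -/
inductive IsRedex : Tm → Prop where
  | beta : ∀ {S t v}, IsValue v → IsRedex (.app (.lam S t) v)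
  | betaT : ∀ {t S}, IsRedex (.tapp (.tlam t) S)
  | callcc : ∀ {t}, IsRedex (.callcc t)
  | throw : ∀ {E v}, IsValue v → IsRedex (.throwCtx E v)

/-- `Norm p`: the program `p` evaluates to a value. -/
def Norm (p : Tm) : Prop := ∃ v, IsValue v ∧ Steps p v

/-- A reducibility candidate of type `S` is a set of closed values of type `S`. -/
def IsCand (S : Ty) (R : Set Tm) : Prop :=
  ∀ v ∈ R, IsValue v ∧ ClosedTm v ∧ HasTy [] [] v S

/-- `CtxOK R E` is the predicate `R ⊨ E`, i.e. `∀ v ∈ R, norm (E[v])`. -/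
def CtxOK (R : Set Tm) (E : Ctx) : Prop := ∀ v ∈ R, Norm (plug v E)

/-- `CtxAdm A R E`: `E` is a closed context of type `¬A` with `R ⊨ E`. -/
def CtxAdm (A : Ty) (R : Set Tm) (E : Ctx) : Prop :=
  ClosedCtx E ∧ HasTyCtx [] [] E A ∧ CtxOK R E

/-- The parametric reducibility candidate `RED_S(ᾱ ↦ R̄)` (call by value),
defined by induction on `S`.  `Ts` are the types of the candidates `Rs`. -/
def RED : Ty → List Ty → List (Set Tm) → Set Tm
  | .var i, _, Rs => Rs.getD i ∅
  | .arrow S1 S2, Ts, Rs =>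
      {v0 | IsValue v0 ∧ ClosedTm v0 ∧ HasTy [] [] v0 (subTyList Ts (.arrow S1 S2)) ∧
        ∀ v1 ∈ RED S1 Ts Rs, ∀ E, CtxAdm (subTyList Ts S2) (RED S2 Ts Rs) E →
          Norm (plug (.app v0 v1) E)}
  | .all S, Ts, Rs =>
      {v | IsValue v ∧ ClosedTm v ∧ HasTy [] [] v (subTyList Ts (.all S)) ∧
        ∀ (U : Ty) (Rc : Set Tm), IsCand U Rc →
          ∀ E, CtxAdm (subTyList (U::Ts) S) (RED S (U::Ts) (Rc::Rs)) E →
            Norm (plug (.tapp v U) E)}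

end LambdaFv
namespace LambdaFv

/-- Call-by-name evaluation contexts: `E ::= [] | E t | E S`. -/
inductive IsCbnCtx : Ctx → Prop where
  | hole : IsCbnCtx .hole
  | app : ∀ {E t}, IsCbnCtx E → IsCbnCtx (.app E t)
  | tapp : ∀ {E S}, IsCbnCtx E → IsCbnCtx (.tapp E S)

/-- The call-by-name one-step reduction relation `→n` of `λFv`. -/
inductive StepN : Tm → Tm → Prop where
  | beta : ∀ {S t0 t1 E}, IsCbnCtx E →
      StepN (plug (.app (.lam S t0) t1) E) (plug (sub0X t1 t0) E)
  | betaT : ∀ {t S E}, IsCbnCtx E →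
      StepN (plug (.tapp (.tlam t) S) E) (plug (sub0A S t) E)
  | callcc : ∀ {t E}, IsCbnCtx E →
      StepN (plug (.callcc t) E) (plug (sub0K E t) E)
  | throw : ∀ {E0 E1 t}, IsCbnCtx E1 →
      StepN (plug (.throwCtx E0 t) E1) (plug t E0)

/-- Call-by-name evaluation: the reflexive-transitive closure of `→n`. -/
def StepsN : Tm → Tm → Prop := Relation.ReflTransGen StepN

/-- `NormN p`: the program `p` evaluates to a value under call by name. -/
def NormN (p : Tm) : Prop := ∃ v, IsValue v ∧ StepsN p v

/-- Typing of call-by-name contexts (Figure 1, restricted to cbn contexts). -/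
inductive HasTyCtxN : List Ty → List Ty → Ctx → Ty → Prop where
  | hole : ∀ {Γ Δ S}, HasTyCtxN Γ Δ .hole S
  | app : ∀ {Γ Δ S T t E}, HasTy Γ Δ t S → HasTyCtxN Γ Δ E T →
      HasTyCtxN Γ Δ (.app E t) (.arrow S T)
  | tapp : ∀ {Γ Δ S T E}, HasTyCtxN Γ Δ E (subTy0 T S) →
      HasTyCtxN Γ Δ (.tapp E T) (.all S)

/-- `CtxOKN R E` is the call-by-name predicate `R ⊨ E`. -/
def CtxOKN (R : Set Tm) (E : Ctx) : Prop := ∀ v ∈ R, NormN (plug v E)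

/-- `CtxAdmN A R E`: `E` is a closed call-by-name context of type `¬A` with `R ⊨ E`. -/
def CtxAdmN (A : Ty) (R : Set Tm) (E : Ctx) : Prop :=
  IsCbnCtx E ∧ ClosedCtx E ∧ HasTyCtxN [] [] E A ∧ CtxOKN R E

/-- `QN A R t`: for all closed contexts `E` of type `¬A` with `R ⊨ E`,
`norm (E[t])` holds (`A` is the type of the candidate `R`). -/
def QN (A : Ty) (R : Set Tm) (t : Tm) : Prop :=
  ∀ E, CtxAdmN A R E → NormN (plug t E)

/-- The call-by-name parametric reducibility candidate `RED_S(ᾱ ↦ R̄)`. -/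
def REDN : Ty → List Ty → List (Set Tm) → Set Tm
  | .var i, _, Rs => Rs.getD i ∅
  | .arrow S1 S2, Ts, Rs =>
      {v | IsValue v ∧ ClosedTm v ∧ HasTy [] [] v (subTyList Ts (.arrow S1 S2)) ∧
        ∀ t, ClosedTm t → QN (subTyList Ts S1) (REDN S1 Ts Rs) t →
          QN (subTyList Ts S2) (REDN S2 Ts Rs) (.app v t)}
  | .all S, Ts, Rs =>
      {v | IsValue v ∧ ClosedTm v ∧ HasTy [] [] v (subTyList Ts (.all S)) ∧
        ∀ (U : Ty) (Rc : Set Tm), IsCand U Rc →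
          ∀ E, CtxAdmN (subTyList (U::Ts) S) (REDN S (U::Ts) (Rc::Rs)) E →
            NormN (plug (.tapp v U) E)}

end LambdaFv
namespace LambdaFv

/-! ### Renaming and substitution in types -/

theorem liftRen_comp (r s : Nat → Nat) :
    (fun n => liftRen r (liftRen s n)) = liftRen (fun n => r (s n)) := by
  funext n; cases n <;> rfl

theorem liftRen_id : liftRen (fun n => n) = fun n => n := by
  funext n; cases n <;> rfl

theorem renTy_renTy (A : Ty) (r s : Nat → Nat) :
    renTy r (renTy s A) = renTy (fun n => r (s n)) A := by
  induction A generalizing r s with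
  | var n => rfl
  | arrow A B ihA ihB => simp only [renTy, ihA, ihB]
  | all A ih => simp only [renTy, ih, liftRen_comp]

theorem liftTySub_liftRen (σ : Nat → Ty) (r : Nat → Nat) :
    (fun n => liftTySub σ (liftRen r n)) = liftTySub (fun n => σ (r n)) := by
  funext n; cases n <;> rfl

theorem subTy_renTy (A : Ty) (σ : Nat → Ty) (r : Nat → Nat) :
    subTy σ (renTy r A) = subTy (fun n => σ (r n)) A := by
  induction A generalizing σ r with
  | var n => rfl
  | arrow A B ihA ihB => simp only [renTy, subTy, ihA, ihB]
  | all A ih => simp only [renTy, subTy, ih, liftTySub_liftRen]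

theorem renTy_liftTySub (r : Nat → Nat) (σ : Nat → Ty) :
    (fun n => renTy (liftRen r) (liftTySub σ n)) = liftTySub (fun n => renTy r (σ n)) := by
  funext n
  cases n with
  | zero => rfl
  | succ n => simp only [liftTySub, renTy_renTy]; rfl

theorem renTy_subTy (A : Ty) (r : Nat → Nat) (σ : Nat → Ty) :
    renTy r (subTy σ A) = subTy (fun n => renTy r (σ n)) A := by
  induction A generalizing σ r with
  | var n => rfl
  | arrow A B ihA ihB => simp only [renTy, subTy, ihA, ihB]
  | all A ih => simp only [renTy, subTy, ih, renTy_liftTySub]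

theorem subTy_liftTySub (τ σ : Nat → Ty) :
    (fun n => subTy (liftTySub τ) (liftTySub σ n)) = liftTySub (fun n => subTy τ (σ n)) := by
  funext n
  cases n with
  | zero => rfl
  | succ n => simp only [liftTySub, subTy_renTy, renTy_subTy]

theorem subTy_subTy (A : Ty) (τ σ : Nat → Ty) :
    subTy τ (subTy σ A) = subTy (fun n => subTy τ (σ n)) A := by
  induction A generalizing σ τ with
  | var n => rfl
  | arrow A B ihA ihB => simp only [subTy, ihA, ihB]
  | all A ih => simp only [subTy, ih, subTy_liftTySub]

theorem liftTySub_var : liftTySub Ty.var = Ty.var := by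
  funext n; cases n <;> rfl

theorem subTy_var (A : Ty) : subTy Ty.var A = A := by
  induction A with
  | var n => rfl
  | arrow A B ihA ihB => simp only [subTy, ihA, ihB]
  | all A ih => simp only [subTy, liftTySub_var, ih]

/-! ### Composition of renamings in terms and contexts -/

mutual
theorem renTm_renTm (rx rk ra sx sk sa : Nat → Nat) : (t : Tm) →
    renTm rx rk ra (renTm sx sk sa t) =
      renTm (fun n => rx (sx n)) (fun n => rk (sk n)) (fun n => ra (sa n)) t
  | .var n => rfl
  | .lam S t => by simp only [renTm, renTy_renTy, renTm_renTm _ _ _ _ _ _ t, liftRen_comp]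
  | .app a b => by
    simp only [renTm, renTm_renTm _ _ _ _ _ _ a, renTm_renTm _ _ _ _ _ _ b]
  | .tlam t => by simp only [renTm, renTm_renTm _ _ _ _ _ _ t, liftRen_comp]
  | .tapp t S => by simp only [renTm, renTy_renTy, renTm_renTm _ _ _ _ _ _ t]
  | .callcc t => by simp only [renTm, renTm_renTm _ _ _ _ _ _ t, liftRen_comp]
  | .throwVar k t => by simp only [renTm, renTm_renTm _ _ _ _ _ _ t]
  | .throwCtx E t => by
    simp only [renTm, renTm_renTm _ _ _ _ _ _ t, renCtx_renCtx _ _ _ _ _ _ E]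

theorem renCtx_renCtx (rx rk ra sx sk sa : Nat → Nat) : (E : Ctx) →
    renCtx rx rk ra (renCtx sx sk sa E) =
      renCtx (fun n => rx (sx n)) (fun n => rk (sk n)) (fun n => ra (sa n)) E
  | .hole => rfl
  | .lamApp S t E => by
    simp only [renCtx, renTy_renTy, renTm_renTm _ _ _ _ _ _ t, renCtx_renCtx _ _ _ _ _ _ E,
      liftRen_comp]
  | .app E t => by
    simp only [renCtx, renTm_renTm _ _ _ _ _ _ t, renCtx_renCtx _ _ _ _ _ _ E]
  | .tapp E S => by simp only [renCtx, renTy_renTy, renCtx_renCtx _ _ _ _ _ _ E]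
  | .throw E F => by
    simp only [renCtx, renCtx_renCtx _ _ _ _ _ _ E, renCtx_renCtx _ _ _ _ _ _ F]
end

/-! ### Substitution after renaming -/

theorem liftSubX_liftRen (σ : Nat → Tm) (r : Nat → Nat) :
    (fun n => liftSubX σ (liftRen r n)) = liftSubX (fun n => σ (r n)) := by
  funext n; cases n <;> rfl

theorem liftSubK_liftRen (σ : Nat → Ctx ⊕ Nat) (r : Nat → Nat) :
    (fun n => liftSubK σ (liftRen r n)) = liftSubK (fun n => σ (r n)) := by
  funext n; cases n <;> rfl

mutual
theorem subTm_renTm (σx : Nat → Tm) (σk : Nat → Ctx ⊕ Nat) (σa : Nat → Ty)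
    (rx rk ra : Nat → Nat) : (t : Tm) →
    subTm σx σk σa (renTm rx rk ra t) =
      subTm (fun n => σx (rx n)) (fun n => σk (rk n)) (fun n => σa (ra n)) t
  | .var n => rfl
  | .lam S t => by
    simp only [renTm, subTm, subTy_renTy, subTm_renTm _ _ _ _ _ _ t, liftSubX_liftRen]
    rfl
  | .app a b => by
    simp only [renTm, subTm, subTm_renTm _ _ _ _ _ _ a, subTm_renTm _ _ _ _ _ _ b]
  | .tlam t => by
    simp only [renTm, subTm, subTm_renTm _ _ _ _ _ _ t, liftTySub_liftRen]
    rfl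
  | .tapp t S => by simp only [renTm, subTm, subTy_renTy, subTm_renTm _ _ _ _ _ _ t]
  | .callcc t => by
    simp only [renTm, subTm, subTm_renTm _ _ _ _ _ _ t, liftSubK_liftRen]
    rfl
  | .throwVar k t => by simp only [renTm, subTm, subTm_renTm _ _ _ _ _ _ t]
  | .throwCtx E t => by
    simp only [renTm, subTm, subTm_renTm _ _ _ _ _ _ t, subCtx_renCtx _ _ _ _ _ _ E]

theorem subCtx_renCtx (σx : Nat → Tm) (σk : Nat → Ctx ⊕ Nat) (σa : Nat → Ty)
    (rx rk ra : Nat → Nat) : (E : Ctx) →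
    subCtx σx σk σa (renCtx rx rk ra E) =
      subCtx (fun n => σx (rx n)) (fun n => σk (rk n)) (fun n => σa (ra n)) E
  | .hole => rfl
  | .lamApp S t E => by
    simp only [renCtx, subCtx, subTy_renTy, subTm_renTm _ _ _ _ _ _ t,
      subCtx_renCtx _ _ _ _ _ _ E, liftSubX_liftRen]
    rfl
  | .app E t => by
    simp only [renCtx, subCtx, subTm_renTm _ _ _ _ _ _ t, subCtx_renCtx _ _ _ _ _ _ E]
  | .tapp E S => by simp only [renCtx, subCtx, subTy_renTy, subCtx_renCtx _ _ _ _ _ _ E]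
  | .throw E F => by
    simp only [renCtx, subCtx, subCtx_renCtx _ _ _ _ _ _ E, subCtx_renCtx _ _ _ _ _ _ F]
end

/-! ### Renaming after substitution -/

/-- Renaming of an entry of a continuation substitution. -/
def renEnt (rx rk ra : Nat → Nat) : Ctx ⊕ Nat → Ctx ⊕ Nat
  | .inl E => .inl (renCtx rx rk ra E)
  | .inr n => .inr (rk n)

theorem renTm_liftSubX (rx rk ra : Nat → Nat) (σ : Nat → Tm) :
    (fun n => renTm (liftRen rx) rk ra (liftSubX σ n)) =
      liftSubX (fun n => renTm rx rk ra (σ n)) := by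
  funext n
  cases n with
  | zero => rfl
  | succ n => simp only [liftSubX, renTm_renTm]; rfl

theorem renTm_shiftSubXk (rx rk ra : Nat → Nat) (σ : Nat → Tm) :
    (fun n => renTm rx (liftRen rk) ra (shiftSubXk σ n)) =
      shiftSubXk (fun n => renTm rx rk ra (σ n)) := by
  funext n
  simp only [shiftSubXk, renTm_renTm]; rfl

theorem renTm_shiftSubXa (rx rk ra : Nat → Nat) (σ : Nat → Tm) :
    (fun n => renTm rx rk (liftRen ra) (shiftSubXa σ n)) =
      shiftSubXa (fun n => renTm rx rk ra (σ n)) := by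
  funext n
  simp only [shiftSubXa, renTm_renTm]; rfl

theorem renEnt_shiftSubKx (rx rk ra : Nat → Nat) (σ : Nat → Ctx ⊕ Nat) :
    (fun n => renEnt (liftRen rx) rk ra (shiftSubKx σ n)) =
      shiftSubKx (fun n => renEnt rx rk ra (σ n)) := by
  funext n
  simp only [shiftSubKx]
  cases σ n with
  | inl E => simp only [mapKEnt, renEnt, renCtx_renCtx]; rfl
  | inr m => rfl

theorem renEnt_shiftSubKa (rx rk ra : Nat → Nat) (σ : Nat → Ctx ⊕ Nat) :
    (fun n => renEnt rx rk (liftRen ra) (shiftSubKa σ n)) =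
      shiftSubKa (fun n => renEnt rx rk ra (σ n)) := by
  funext n
  simp only [shiftSubKa]
  cases σ n with
  | inl E => simp only [mapKEnt, renEnt, renCtx_renCtx]; rfl
  | inr m => rfl

theorem renEnt_liftSubK (rx rk ra : Nat → Nat) (σ : Nat → Ctx ⊕ Nat) :
    (fun n => renEnt rx (liftRen rk) ra (liftSubK σ n)) =
      liftSubK (fun n => renEnt rx rk ra (σ n)) := by
  funext n
  cases n with
  | zero => rfl
  | succ n =>
    simp only [liftSubK]
    cases σ n with
    | inl E => simp only [renEnt, renCtx_renCtx]; rfl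
    | inr m => rfl

mutual
theorem renTm_subTm (rx rk ra : Nat → Nat) (σx : Nat → Tm) (σk : Nat → Ctx ⊕ Nat)
    (σa : Nat → Ty) : (t : Tm) →
    renTm rx rk ra (subTm σx σk σa t) =
      subTm (fun n => renTm rx rk ra (σx n)) (fun n => renEnt rx rk ra (σk n))
        (fun n => renTy ra (σa n)) t
  | .var n => rfl
  | .lam S t => by
    simp only [renTm, subTm, renTy_subTy, renTm_subTm _ _ _ _ _ _ t, renTm_liftSubX,
      renEnt_shiftSubKx]
  | .app a b => by
    simp only [renTm, subTm, renTm_subTm _ _ _ _ _ _ a, renTm_subTm _ _ _ _ _ _ b]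
  | .tlam t => by
    simp only [renTm, subTm, renTm_subTm _ _ _ _ _ _ t, renTm_shiftSubXa, renEnt_shiftSubKa,
      renTy_liftTySub]
  | .tapp t S => by simp only [renTm, subTm, renTy_subTy, renTm_subTm _ _ _ _ _ _ t]
  | .callcc t => by
    simp only [renTm, subTm, renTm_subTm _ _ _ _ _ _ t, renTm_shiftSubXk, renEnt_liftSubK]
  | .throwVar k t => by
    simp only [subTm, ← renTm_subTm rx rk ra σx σk σa t]
    cases σk k <;> rfl
  | .throwCtx E t => by
    simp only [renTm, subTm, renTm_subTm _ _ _ _ _ _ t, renCtx_subCtx _ _ _ _ _ _ E]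

theorem renCtx_subCtx (rx rk ra : Nat → Nat) (σx : Nat → Tm) (σk : Nat → Ctx ⊕ Nat)
    (σa : Nat → Ty) : (E : Ctx) →
    renCtx rx rk ra (subCtx σx σk σa E) =
      subCtx (fun n => renTm rx rk ra (σx n)) (fun n => renEnt rx rk ra (σk n))
        (fun n => renTy ra (σa n)) E
  | .hole => rfl
  | .lamApp S t E => by
    simp only [renCtx, subCtx, renTy_subTy, renTm_subTm _ _ _ _ _ _ t,
      renCtx_subCtx _ _ _ _ _ _ E, renTm_liftSubX, renEnt_shiftSubKx]
  | .app E t => by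
    simp only [renCtx, subCtx, renTm_subTm _ _ _ _ _ _ t, renCtx_subCtx _ _ _ _ _ _ E]
  | .tapp E S => by simp only [renCtx, subCtx, renTy_subTy, renCtx_subCtx _ _ _ _ _ _ E]
  | .throw E F => by
    simp only [renCtx, subCtx, renCtx_subCtx _ _ _ _ _ _ E, renCtx_subCtx _ _ _ _ _ _ F]
end

/-! ### Composition of substitutions -/

/-- Substitution in an entry of a continuation substitution. -/
def subEnt (σx : Nat → Tm) (σk : Nat → Ctx ⊕ Nat) (σa : Nat → Ty) : Ctx ⊕ Nat → Ctx ⊕ Nat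
  | .inl E => .inl (subCtx σx σk σa E)
  | .inr n => σk n

theorem shiftSubKx_eq (σ : Nat → Ctx ⊕ Nat) :
    shiftSubKx σ = fun n => renEnt Nat.succ id id (σ n) := by
  funext n; simp only [shiftSubKx]; cases σ n <;> rfl

theorem shiftSubKa_eq (σ : Nat → Ctx ⊕ Nat) :
    shiftSubKa σ = fun n => renEnt id id Nat.succ (σ n) := by
  funext n; simp only [shiftSubKa]; cases σ n <;> rfl

theorem liftSubK_succ (σ : Nat → Ctx ⊕ Nat) (n : Nat) :
    liftSubK σ (n + 1) = renEnt id Nat.succ id (σ n) := by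
  simp only [liftSubK]; cases σ n <;> rfl

theorem renTy_id (A : Ty) : renTy id A = A := by
  have h : liftRen id = id := liftRen_id
  induction A with
  | var n => rfl
  | arrow A B ihA ihB => simp only [renTy, ihA, ihB]
  | all A ih => simp only [renTy, h, ih]

theorem renEnt_subEnt (rx rk ra : Nat → Nat) (σx : Nat → Tm) (σk : Nat → Ctx ⊕ Nat)
    (σa : Nat → Ty) (e : Ctx ⊕ Nat) :
    renEnt rx rk ra (subEnt σx σk σa e) =
      subEnt (fun n => renTm rx rk ra (σx n)) (fun n => renEnt rx rk ra (σk n))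
        (fun n => renTy ra (σa n)) e := by
  cases e with
  | inl E => simp only [subEnt, renEnt, renCtx_subCtx]
  | inr m => rfl

theorem subEnt_renEnt (σx : Nat → Tm) (σk : Nat → Ctx ⊕ Nat) (σa : Nat → Ty)
    (rx rk ra : Nat → Nat) (e : Ctx ⊕ Nat) :
    subEnt σx σk σa (renEnt rx rk ra e) =
      subEnt (fun n => σx (rx n)) (fun n => σk (rk n)) (fun n => σa (ra n)) e := by
  cases e with
  | inl E => simp only [subEnt, renEnt, subCtx_renCtx]
  | inr m => rfl

theorem subTm_liftSubX (τx : Nat → Tm) (τk : Nat → Ctx ⊕ Nat) (τa : Nat → Ty) (σ : Nat → Tm) :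
    (fun n => subTm (liftSubX τx) (shiftSubKx τk) τa (liftSubX σ n)) =
      liftSubX (fun n => subTm τx τk τa (σ n)) := by
  funext n
  cases n with
  | zero => rfl
  | succ n =>
    simp only [liftSubX, subTm_renTm, renTm_subTm, shiftSubKx_eq, renTy_id, id]

theorem subTm_shiftSubXk (τx : Nat → Tm) (τk : Nat → Ctx ⊕ Nat) (τa : Nat → Ty)
    (σ : Nat → Tm) :
    (fun n => subTm (shiftSubXk τx) (liftSubK τk) τa (shiftSubXk σ n)) =
      shiftSubXk (fun n => subTm τx τk τa (σ n)) := by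
  funext n
  simp only [shiftSubXk, subTm_renTm, renTm_subTm, Nat.succ_eq_add_one, liftSubK_succ, renTy_id,
    id]

theorem subTm_shiftSubXa (τx : Nat → Tm) (τk : Nat → Ctx ⊕ Nat) (τa : Nat → Ty)
    (σ : Nat → Tm) :
    (fun n => subTm (shiftSubXa τx) (shiftSubKa τk) (liftTySub τa) (shiftSubXa σ n)) =
      shiftSubXa (fun n => subTm τx τk τa (σ n)) := by
  funext n
  simp only [shiftSubXa, subTm_renTm, renTm_subTm, shiftSubKa_eq, liftTySub, id]

theorem subEnt_shiftSubKx (τx : Nat → Tm) (τk : Nat → Ctx ⊕ Nat) (τa : Nat → Ty)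
    (σ : Nat → Ctx ⊕ Nat) :
    (fun n => subEnt (liftSubX τx) (shiftSubKx τk) τa (shiftSubKx σ n)) =
      shiftSubKx (fun n => subEnt τx τk τa (σ n)) := by
  simp only [shiftSubKx_eq, subEnt_renEnt, renEnt_subEnt, liftSubX, renTy_id, id]

theorem subEnt_shiftSubKa (τx : Nat → Tm) (τk : Nat → Ctx ⊕ Nat) (τa : Nat → Ty)
    (σ : Nat → Ctx ⊕ Nat) :
    (fun n => subEnt (shiftSubXa τx) (shiftSubKa τk) (liftTySub τa) (shiftSubKa σ n)) =
      shiftSubKa (fun n => subEnt τx τk τa (σ n)) := by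
  simp only [shiftSubKa_eq, subEnt_renEnt, renEnt_subEnt, shiftSubXa, liftTySub, id]

theorem subEnt_liftSubK (τx : Nat → Tm) (τk : Nat → Ctx ⊕ Nat) (τa : Nat → Ty)
    (σ : Nat → Ctx ⊕ Nat) :
    (fun n => subEnt (shiftSubXk τx) (liftSubK τk) τa (liftSubK σ n)) =
      liftSubK (fun n => subEnt τx τk τa (σ n)) := by
  funext n
  cases n with
  | zero => rfl
  | succ n =>
    simp only [liftSubK_succ, subEnt_renEnt, renEnt_subEnt, Nat.succ_eq_add_one, shiftSubXk,
      renTy_id, id]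

mutual
theorem subTm_subTm (τx : Nat → Tm) (τk : Nat → Ctx ⊕ Nat) (τa : Nat → Ty)
    (σx : Nat → Tm) (σk : Nat → Ctx ⊕ Nat) (σa : Nat → Ty) : (t : Tm) →
    subTm τx τk τa (subTm σx σk σa t) =
      subTm (fun n => subTm τx τk τa (σx n)) (fun n => subEnt τx τk τa (σk n))
        (fun n => subTy τa (σa n)) t
  | .var n => rfl
  | .lam S t => by
    simp only [subTm, subTy_subTy, subTm_subTm _ _ _ _ _ _ t, subTm_liftSubX,
      subEnt_shiftSubKx]
  | .app a b => by
    simp only [subTm, subTm_subTm _ _ _ _ _ _ a, subTm_subTm _ _ _ _ _ _ b]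
  | .tlam t => by
    simp only [subTm, subTm_subTm _ _ _ _ _ _ t, subTm_shiftSubXa, subEnt_shiftSubKa,
      subTy_liftTySub]
  | .tapp t S => by simp only [subTm, subTy_subTy, subTm_subTm _ _ _ _ _ _ t]
  | .callcc t => by
    simp only [subTm, subTm_subTm _ _ _ _ _ _ t, subTm_shiftSubXk, subEnt_liftSubK]
  | .throwVar k t => by
    simp only [subTm, ← subTm_subTm τx τk τa σx σk σa t]
    cases σk k <;> rfl
  | .throwCtx E t => by
    simp only [subTm, subTm_subTm _ _ _ _ _ _ t, subCtx_subCtx _ _ _ _ _ _ E]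

theorem subCtx_subCtx (τx : Nat → Tm) (τk : Nat → Ctx ⊕ Nat) (τa : Nat → Ty)
    (σx : Nat → Tm) (σk : Nat → Ctx ⊕ Nat) (σa : Nat → Ty) : (E : Ctx) →
    subCtx τx τk τa (subCtx σx σk σa E) =
      subCtx (fun n => subTm τx τk τa (σx n)) (fun n => subEnt τx τk τa (σk n))
        (fun n => subTy τa (σa n)) E
  | .hole => rfl
  | .lamApp S t E => by
    simp only [subCtx, subTy_subTy, subTm_subTm _ _ _ _ _ _ t,
      subCtx_subCtx _ _ _ _ _ _ E, subTm_liftSubX, subEnt_shiftSubKx]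
  | .app E t => by
    simp only [subCtx, subTm_subTm _ _ _ _ _ _ t, subCtx_subCtx _ _ _ _ _ _ E]
  | .tapp E S => by simp only [subCtx, subTy_subTy, subCtx_subCtx _ _ _ _ _ _ E]
  | .throw E F => by
    simp only [subCtx, subCtx_subCtx _ _ _ _ _ _ E, subCtx_subCtx _ _ _ _ _ _ F]
end

/-! ### The identity substitution -/

theorem liftSubX_var : liftSubX Tm.var = Tm.var := by
  funext n; cases n <;> rfl

theorem liftSubK_inr : liftSubK Sum.inr = Sum.inr := by
  funext n; cases n <;> rfl

theorem shiftSubXk_var : shiftSubXk Tm.var = Tm.var := rfl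

theorem shiftSubXa_var : shiftSubXa Tm.var = Tm.var := rfl

theorem shiftSubKx_inr : shiftSubKx Sum.inr = Sum.inr := rfl

theorem shiftSubKa_inr : shiftSubKa Sum.inr = Sum.inr := rfl

mutual
theorem subTm_id : (t : Tm) → subTm Tm.var Sum.inr Ty.var t = t
  | .var n => rfl
  | .lam S t => by simp only [subTm, subTy_var, liftSubX_var, shiftSubKx_inr, subTm_id t]
  | .app a b => by simp only [subTm, subTm_id a, subTm_id b]
  | .tlam t => by
    simp only [subTm, liftTySub_var, shiftSubXa_var, shiftSubKa_inr, subTm_id t]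
  | .tapp t S => by simp only [subTm, subTy_var, subTm_id t]
  | .callcc t => by simp only [subTm, shiftSubXk_var, liftSubK_inr, subTm_id t]
  | .throwVar k t => by simp only [subTm, subTm_id t]
  | .throwCtx E t => by simp only [subTm, subCtx_id E, subTm_id t]

theorem subCtx_id : (E : Ctx) → subCtx Tm.var Sum.inr Ty.var E = E
  | .hole => rfl
  | .lamApp S t E => by
    simp only [subCtx, subTy_var, liftSubX_var, shiftSubKx_inr, subTm_id t, subCtx_id E]
  | .app E t => by simp only [subCtx, subCtx_id E, subTm_id t]
  | .tapp E S => by simp only [subCtx, subTy_var, subCtx_id E]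
  | .throw E F => by simp only [subCtx, subCtx_id E, subCtx_id F]
end

theorem subEnt_id (e : Ctx ⊕ Nat) : subEnt Tm.var Sum.inr Ty.var e = e := by
  cases e with
  | inl E => simp only [subEnt, subCtx_id]
  | inr n => rfl

/-! ### Instantiating a lifted substitution -/

/-- Extension of a sequence by a new entry at index `0`. -/
def scons {α : Type} (a : α) (f : Nat → α) : Nat → α
  | 0 => a
  | n + 1 => f n

theorem sub0X_subTm (u : Tm) (σx : Nat → Tm) (σk : Nat → Ctx ⊕ Nat) (σa : Nat → Ty) (t : Tm) :
    sub0X u (subTm (liftSubX σx) (shiftSubKx σk) σa t) = subTm (scons u σx) σk σa t := by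
  rw [sub0X, subTm_subTm]
  congr 1
  · funext n
    cases n with
    | zero => rfl
    | succ n => simp only [liftSubX, subTm_renTm, id, scons, subTm_id]
  · funext n
    simp only [shiftSubKx_eq, subEnt_renEnt, id, subEnt_id]
  · funext n
    exact subTy_var _

theorem sub0K_subTm (E : Ctx) (σx : Nat → Tm) (σk : Nat → Ctx ⊕ Nat) (σa : Nat → Ty) (t : Tm) :
    sub0K E (subTm (shiftSubXk σx) (liftSubK σk) σa t) =
      subTm σx (scons (.inl E) σk) σa t := by
  rw [sub0K, subTm_subTm]
  congr 1
  · funext n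
    simp only [shiftSubXk, subTm_renTm, id, subTm_id]
  · funext n
    cases n with
    | zero => rfl
    | succ n => simp only [liftSubK_succ, subEnt_renEnt, id, scons, subEnt_id]
  · funext n
    exact subTy_var _

theorem sub0A_subTm (U : Ty) (σx : Nat → Tm) (σk : Nat → Ctx ⊕ Nat) (σa : Nat → Ty) (t : Tm) :
    sub0A U (subTm (shiftSubXa σx) (shiftSubKa σk) (liftTySub σa) t) =
      subTm σx σk (scons U σa) t := by
  rw [sub0A, subTm_subTm]
  congr 1
  · funext n
    simp only [shiftSubXa, subTm_renTm, id, subTm_id]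
  · funext n
    simp only [shiftSubKa_eq, subEnt_renEnt, id, subEnt_id]
  · funext n
    cases n with
    | zero => rfl
    | succ n => simp only [liftTySub, subTy_renTy, scons, subTy_var]

/-! ### Realizability -/

/-- A falsity candidate: a set of call-by-name contexts containing the empty context. -/
def IsFalsity (R : Set Ctx) : Prop := Ctx.hole ∈ R ∧ ∀ E ∈ R, IsCbnCtx E

/-- The falsity value of a type: the call-by-name contexts against which its realizers are
tested, given falsity values for the type variables. -/
def falsity : Ty → (Nat → Set Ctx) → Set Ctx
  | .var n, η => η n
  | .arrow A B, η =>
      {F | F = .hole ∨ ∃ E u, F = .app E u ∧ E ∈ falsity B η ∧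
        ∀ E' ∈ falsity A η, NormN (plug u E')}
  | .all A, η =>
      {F | F = .hole ∨ ∃ E U R, F = .tapp E U ∧ IsFalsity R ∧ E ∈ falsity A (scons R η)}

/-- A term realizes a type when it normalizes in every context of the falsity value. -/
def Realizes (η : Nat → Set Ctx) (t : Tm) (A : Ty) : Prop :=
  ∀ E ∈ falsity A η, NormN (plug t E)

theorem isFalsity_scons {R : Set Ctx} {η : Nat → Set Ctx} (hR : IsFalsity R)
    (hη : ∀ n, IsFalsity (η n)) (n : Nat) : IsFalsity (scons R η n) := by
  cases n with
  | zero => exact hR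
  | succ n => exact hη n

theorem isFalsity_falsity (A : Ty) {η : Nat → Set Ctx} (hη : ∀ n, IsFalsity (η n)) :
    IsFalsity (falsity A η) := by
  induction A generalizing η with
  | var n => exact hη n
  | arrow A B _ ihB =>
    refine ⟨Or.inl rfl, ?_⟩
    rintro F (rfl | ⟨E, u, rfl, hE, _⟩)
    · exact .hole
    · exact .app ((ihB hη).2 E hE)
  | all A ih =>
    refine ⟨Or.inl rfl, ?_⟩
    rintro F (rfl | ⟨E, U, R, rfl, hR, hE⟩)
    · exact .hole
    · exact .tapp ((ih (isFalsity_scons hR hη)).2 E hE)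

theorem falsity_renTy (A : Ty) (r : Nat → Nat) (η : Nat → Set Ctx) :
    falsity (renTy r A) η = falsity A (fun n => η (r n)) := by
  induction A generalizing r η with
  | var n => rfl
  | arrow A B ihA ihB => simp only [renTy, falsity, ihA, ihB]
  | all A ih =>
    have h (R : Set Ctx) :
        (fun n => scons R η (liftRen r n)) = scons R (fun n => η (r n)) := by
      funext n; cases n <;> rfl
    simp only [renTy, falsity, ih, h]

theorem falsity_subTy (A : Ty) (σ : Nat → Ty) (η : Nat → Set Ctx) :
    falsity (subTy σ A) η = falsity A (fun n => falsity (σ n) η) := by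
  induction A generalizing σ η with
  | var n => rfl
  | arrow A B ihA ihB => simp only [subTy, falsity, ihA, ihB]
  | all A ih =>
    have h (R : Set Ctx) :
        (fun n => falsity (liftTySub σ n) (scons R η)) =
          scons R (fun n => falsity (σ n) η) := by
      funext n
      cases n with
      | zero => rfl
      | succ n => simp only [liftTySub, falsity_renTy, scons]
    simp only [subTy, falsity, ih, h]

theorem falsity_subTy0 (T A : Ty) (η : Nat → Set Ctx) :
    falsity (subTy0 T A) η = falsity A (scons (falsity T η) η) := by
  rw [subTy0, falsity_subTy]
  congr 1
  funext n; cases n <;> rfl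

theorem falsity_renTy_succ (A : Ty) (R : Set Ctx) (η : Nat → Set Ctx) :
    falsity (renTy Nat.succ A) (scons R η) = falsity A η :=
  falsity_renTy A Nat.succ (scons R η)

theorem NormN.of_step {t t' : Tm} (h : StepN t t') (h' : NormN t') : NormN t :=
  let ⟨v, hv, hs⟩ := h'
  ⟨v, hv, .head h hs⟩

/-- Fundamental lemma: plain well-typed terms realize their types, under any substitution of
realizers for term variables and tested contexts for continuation variables. -/
theorem realizes_subTm {t : Tm} (ht : Plain t) {Γ Δ : List Ty} {S : Ty} (hty : HasTy Γ Δ t S)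
    {η : Nat → Set Ctx} (hη : ∀ n, IsFalsity (η n))
    {σx : Nat → Tm} {σk : Nat → Ctx ⊕ Nat} {σa : Nat → Ty}
    (hx : ∀ n A, Γ[n]? = some A → Realizes η (σx n) A)
    (hk : ∀ n A, Δ[n]? = some A → ∃ E ∈ falsity A η, σk n = .inl E) :
    Realizes η (subTm σx σk σa t) S := by
  induction ht generalizing Γ Δ S η σx σk σa with
  | var =>
    cases hty with
    | var h => exact hx _ _ h
  | lam _ ih =>
    cases hty with
    | lam h =>
      rintro F (rfl | ⟨E, u, rfl, hE, hu⟩)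
      · exact ⟨_, .lam, .refl⟩
      · refine NormN.of_step (.beta ((isFalsity_falsity _ hη).2 E hE)) ?_
        rw [sub0X_subTm]
        refine ih h hη ?_ hk E hE
        rintro (_ | n) A hA
        · cases hA
          exact hu
        · exact hx n A hA
  | app _ _ iha ihb =>
    cases hty with
    | app h₀ h₁ =>
      intro E hE
      exact iha h₀ hη hx hk (.app E _) (Or.inr ⟨E, _, rfl, hE, ihb h₁ hη hx hk⟩)
  | tlam _ ih =>
    cases hty with
    | tlam h =>
      rintro F (rfl | ⟨E, U, R, rfl, hR, hE⟩)
      · exact ⟨_, .tlam, .refl⟩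
      · have hη' := isFalsity_scons hR hη
        refine NormN.of_step (.betaT ((isFalsity_falsity _ hη').2 E hE)) ?_
        rw [sub0A_subTm]
        refine ih h hη' ?_ ?_ E hE
        · intro n A hA
          rw [List.getElem?_map, Option.map_eq_some_iff] at hA
          obtain ⟨B, hB, rfl⟩ := hA
          rw [Realizes, falsity_renTy_succ]
          exact hx n B hB
        · intro n A hA
          rw [List.getElem?_map, Option.map_eq_some_iff] at hA
          obtain ⟨B, hB, rfl⟩ := hA
          rw [falsity_renTy_succ]
          exact hk n B hB
  | tapp _ ih =>
    cases hty with
    | tapp h =>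
      intro E hE
      rw [falsity_subTy0] at hE
      exact ih h hη hx hk (.tapp E _)
        (Or.inr ⟨E, _, _, rfl, isFalsity_falsity _ hη, hE⟩)
  | callcc _ ih =>
    cases hty with
    | callcc h =>
      intro E hE
      refine NormN.of_step (.callcc ((isFalsity_falsity _ hη).2 E hE)) ?_
      rw [sub0K_subTm]
      refine ih h hη hx ?_ E hE
      rintro (_ | n) A hA
      · cases hA
        exact ⟨E, hE, rfl⟩
      · exact hk n A hA
  | throwVar _ ih =>
    cases hty with
    | throwVar hΔ h =>
      intro E hE
      obtain ⟨E₀, hE₀, heq⟩ := hk _ _ hΔ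
      simp only [subTm, heq]
      exact NormN.of_step (.throw ((isFalsity_falsity _ hη).2 E hE)) (ih h hη hx hk E₀ hE₀)

/-- **Termination of call-by-name evaluation in `λFv`.**
If `p` is a well-typed program of call-by-name `λFv` (a closed plain term
typable in the empty environments), then the call-by-name evaluation of `p`
terminates: there exists a value `v` such that `p →n* v`. -/
theorem termination_cbn
    (p : Tm) (hclosed : ClosedTm p) (hplain : Plain p)
    (htyped : ∃ S, HasTy ([] : List Ty) ([] : List Ty) p S) :
    ∃ v, IsValue v ∧ StepsN p v := by
  obtain ⟨S, hS⟩ := htyped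
  have hη : ∀ _ : Nat, IsFalsity {Ctx.hole} := fun _ =>
    ⟨rfl, fun E hE => by rw [Set.mem_singleton_iff.1 hE]; exact .hole⟩
  have h := realizes_subTm (σx := Tm.var) (σk := Sum.inr) (σa := Ty.var) hplain hS hη
    (fun n A hA => by simp at hA) (fun n A hA => by simp at hA)
  rw [subTm_id] at h
  exact h .hole (isFalsity_falsity S hη).1

end LambdaFv
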